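/- Let A be a finite Taylor algebra and ρ ∈ Con(A) an irreducible congruence with Opt(ρ) = 1_A. Then there exists a simple affine algebra Z in HS(A²) having a one-element subuniverse {0}, and there exists a subdirect subuniverse ζ ≤ A×A×Z with pr_{1,2}(ζ) = ρ*, such that for all (a,a',b) ∈ ζ: (a,a') ∈ ρ if and only if b = 0. -/

import Mathlib

namespace Zhuk

/-- A signature: a type of operation symbols with arities. -/
structure Signature where
  ops : Type
  arity : ops → ℕ

/-- An algebra structure of signature `S` on carrier `A`. -/
class SAlg (S : Signature) (A : Type) where
  interp : (o : S.ops) → (Fin (S.arity o) → A) → A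

variable {S : Signature}

/-- Componentwise algebra structure on a product. -/
instance prodSAlg {A B : Type} [SAlg S A] [SAlg S B] : SAlg S (A × B) :=
  ⟨fun o x => (SAlg.interp o fun i => (x i).1, SAlg.interp o fun i => (x i).2)⟩

/-- A subset closed under all the operations. -/
def IsSubuniverse (S : Signature) {A : Type} [SAlg S A] (R : Set A) : Prop :=
  ∀ (o : S.ops) (x : Fin (S.arity o) → A), (∀ i, x i ∈ R) → SAlg.interp o x ∈ R

/-- The algebra structure on (the subtype of) a subuniverse. -/
def subAlg {A : Type} [SAlg S A] (R : Set A) (h : IsSubuniverse S R) : SAlg S ↥R :=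
  ⟨fun o x => ⟨SAlg.interp o fun i => (x i).1, h o _ fun i => (x i).2⟩⟩

/-- Terms of signature `S` in `n` variables. -/
inductive STerm (S : Signature) (n : ℕ) : Type
  | var : Fin n → STerm S n
  | app (o : S.ops) : (Fin (S.arity o) → STerm S n) → STerm S n

/-- Evaluation of a term in an algebra. -/
def STerm.eval {A : Type} [SAlg S A] {n : ℕ} : STerm S n → (Fin n → A) → A
  | .var i, v => v i
  | .app o ts, v => SAlg.interp o fun i => (ts i).eval v

/-- The diagonal (smallest) congruence `0_A`. -/
def diag (A : Type) : Set (A × A) := {p | p.1 = p.2}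

/-- Relational composition. -/
def rcomp {A B C : Type} (R : Set (A × B)) (T : Set (B × C)) : Set (A × C) :=
  {p | ∃ b, (p.1, b) ∈ R ∧ (b, p.2) ∈ T}

/-- Relational inverse. -/
def rinv {A B : Type} (R : Set (A × B)) : Set (B × A) := {p | (p.2, p.1) ∈ R}

/-- Transitive closure of a binary relation (as a set of pairs). -/
def transCl {A : Type} (R : Set (A × A)) : Set (A × A) :=
  {p | Relation.TransGen (fun a b => (a, b) ∈ R) p.1 p.2}

/-- `R` is stable under (saturated with respect to) `ρ`:  `R = ρ ∘ R ∘ ρ`. -/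
def Saturated {A : Type} (ρ R : Set (A × A)) : Prop := rcomp ρ (rcomp R ρ) = R

/-- A congruence: a subuniverse of `A²` which is an equivalence relation. -/
def IsCongruence (S : Signature) {A : Type} [SAlg S A] (θ : Set (A × A)) : Prop :=
  IsSubuniverse S θ ∧ Equivalence fun a b => (a, b) ∈ θ

/-- `ρ ∈ Con*(A)`: a congruence different from the full congruence `1_A`. -/
def ConStar (S : Signature) {A : Type} [SAlg S A] (ρ : Set (A × A)) : Prop :=
  IsCongruence S ρ ∧ ρ ≠ Set.univ

/-- The ternary centralizer relation `C(φ, θ; δ)`, via the term condition. -/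
def Centralizes (S : Signature) {A : Type} [SAlg S A] (φ θ δ : Set (A × A)) : Prop :=
  ∀ (n : ℕ) (t : STerm S (n + 1)) (a b : A) (c d : Fin n → A),
    (a, b) ∈ φ → (∀ i, (c i, d i) ∈ θ) →
    (t.eval (Fin.cons a c), t.eval (Fin.cons a d)) ∈ δ →
    (t.eval (Fin.cons b c), t.eval (Fin.cons b d)) ∈ δ

/-- The centralizer `(δ : θ)`: the largest congruence `φ` with `C(φ, θ; δ)`. -/
def centralizer (S : Signature) {A : Type} [SAlg S A] (δ θ : Set (A × A)) : Set (A × A) :=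
  ⋃₀ {φ | IsCongruence S φ ∧ Centralizes S φ θ δ}

/-- A congruence of the subalgebra `A(θ) ≤ A²`, viewed ambiently as a subset of
`(A×A) × (A×A)` whose field is `θ`. -/
def IsConOn (S : Signature) {A : Type} [SAlg S A] (θ : Set (A × A))
    (Δ : Set ((A × A) × (A × A))) : Prop :=
  Δ ⊆ θ ×ˢ θ ∧ IsSubuniverse S Δ ∧ (∀ p ∈ θ, (p, p) ∈ Δ) ∧
    (∀ p q, (p, q) ∈ Δ → (q, p) ∈ Δ) ∧ (∀ p q r, (p, q) ∈ Δ → (q, r) ∈ Δ → (p, r) ∈ Δ)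

/-- `Δ_{θ,α}`: the congruence of `A(θ)` generated by `{((a,a),(b,b)) : (a,b) ∈ α}`. -/
def DeltaCon (S : Signature) {A : Type} [SAlg S A] (θ α : Set (A × A)) :
    Set ((A × A) × (A × A)) :=
  ⋂₀ {Δ | IsConOn S θ Δ ∧ ∀ a b : A, (a, b) ∈ α → ((a, a), (b, b)) ∈ Δ}

/-- Projection of a quaternary relation to its first two coordinates. -/
def pr12 {A B : Type} (T : Set (A × A × B × B)) : Set (A × A) :=
  {p | ∃ b₁ b₂, (p.1, p.2, b₁, b₂) ∈ T}

/-- Projection of a quaternary relation to its last two coordinates. -/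
def pr34 {A B : Type} (T : Set (A × A × B × B)) : Set (B × B) :=
  {q | ∃ a₁ a₂, (a₁, a₂, q.1, q.2) ∈ T}

/-- The trace of a quaternary relation. -/
def btr {A B : Type} (T : Set (A × A × B × B)) : Set (A × B) :=
  {p | (p.1, p.1, p.2, p.2) ∈ T}

/-- Zhuk's bridges: Definition 4.3 (B0*), (B1*), (B2*). -/
def IsBridge (S : Signature) {A B : Type} [SAlg S A] [SAlg S B]
    (ρ : Set (A × A)) (σ : Set (B × B)) (T : Set (A × A × B × B)) : Prop :=
  IsSubuniverse S T ∧
  (∀ a₁ a₂ b₁ b₂ a₁' a₂', (a₁, a₂, b₁, b₂) ∈ T → (a₁, a₁') ∈ ρ → (a₂, a₂') ∈ ρ →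
    (a₁', a₂', b₁, b₂) ∈ T) ∧
  (∀ a₁ a₂ b₁ b₂ b₁' b₂', (a₁, a₂, b₁, b₂) ∈ T → (b₁, b₁') ∈ σ → (b₂, b₂') ∈ σ →
    (a₁, a₂, b₁', b₂') ∈ T) ∧
  ρ ⊂ pr12 T ∧ σ ⊂ pr34 T ∧
  (∀ a₁ a₂ b₁ b₂, (a₁, a₂, b₁, b₂) ∈ T → ((a₁, a₂) ∈ ρ ↔ (b₁, b₂) ∈ σ))

/-- A bridge from `(A,ρ,L)` to `(B,σ,R)`: a bridge with prescribed anchors. -/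
def IsBridgeLR (S : Signature) {A B : Type} [SAlg S A] [SAlg S B]
    (ρ : Set (A × A)) (σ : Set (B × B)) (L : Set (A × A)) (R : Set (B × B))
    (T : Set (A × A × B × B)) : Prop :=
  IsBridge S ρ σ T ∧ pr12 T = L ∧ pr34 T = R

/-- A reflexive bridge (case `B = A`): `0_A ⊆ tr(T)`. -/
def ReflBridge {A : Type} (T : Set (A × A × A × A)) : Prop :=
  ∀ a : A, (a, a) ∈ btr T

/-- `Cov(ρ)`: the inclusion-minimal ρ-saturated subuniverses of `A²` properly containing ρ. -/
def Cov (S : Signature) {A : Type} [SAlg S A] (ρ : Set (A × A)) : Set (Set (A × A)) :=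
  {L | IsSubuniverse S L ∧ Saturated ρ L ∧ ρ ⊂ L ∧
    ∀ L', IsSubuniverse S L' → Saturated ρ L' → ρ ⊂ L' → L' ⊆ L → L' = L}

/-- `ref.tr(ρ,L)`: traces of reflexive bridges from `(A,ρ,L)` to itself. -/
def refTr (S : Signature) {A : Type} [SAlg S A] (ρ L : Set (A × A)) : Set (Set (A × A)) :=
  {γ | ∃ T : Set (A × A × A × A), IsBridgeLR S ρ ρ L L T ∧ ReflBridge T ∧ btr T = γ}

/-- `γ = Opt(ρ,L)`: `γ` is the (unique) inclusion-maximal member of `ref.tr(ρ,L)`. -/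
def IsOptOf (S : Signature) {A : Type} [SAlg S A] (ρ L γ : Set (A × A)) : Prop :=
  γ ∈ refTr S ρ L ∧ ∀ δ ∈ refTr S ρ L, γ ⊆ δ → δ = γ

/-- `ρ` is meet-irreducible with unique upper cover `ρplus`. -/
def MeetIrredWith (S : Signature) {A : Type} [SAlg S A] (ρ ρplus : Set (A × A)) : Prop :=
  IsCongruence S ρ ∧ ρ ≠ Set.univ ∧ IsCongruence S ρplus ∧ ρ ⊂ ρplus ∧
    ∀ θ, IsCongruence S θ → ρ ⊂ θ → ρplus ⊆ θ

/-- `Cov⁺(ρ) = {τ ∈ Cov(ρ) : τ ⊆ ρ⁺}`. -/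
def CovPlus (S : Signature) {A : Type} [SAlg S A] (ρ ρplus : Set (A × A)) :
    Set (Set (A × A)) :=
  {τ | τ ∈ Cov S ρ ∧ τ ⊆ ρplus}

/-- A good bridge between meet-irreducible congruences with upper covers `ρplus`, `σplus`. -/
def GoodBridge (S : Signature) {A B : Type} [SAlg S A] [SAlg S B]
    (ρ ρplus : Set (A × A)) (σ σplus : Set (B × B)) (T : Set (A × A × B × B)) : Prop :=
  IsBridge S ρ σ T ∧
    ∃ τ ∈ CovPlus S ρ ρplus, ∃ τ' ∈ CovPlus S σ σplus, ∃ T' ⊆ T,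
      IsBridgeLR S ρ σ τ τ' T' ∧ btr T' = btr T

/-- `t` (with Taylor-identity data `u v`) is idempotent on `A` and satisfies the
corresponding identities on `A`. -/
def TaylorOn (S : Signature) (A : Type) [SAlg S A] {n : ℕ} (t : STerm S n)
    (u v : Fin n → Fin n → Fin 2) : Prop :=
  (∀ a : A, t.eval (fun _ => a) = a) ∧
    ∀ (i : Fin n) (x y : A),
      t.eval (fun j => if u i j = 0 then x else y) =
        t.eval (fun j => if v i j = 0 then x else y)

/-- `A` is a Taylor algebra. -/
def IsTaylorAlg (S : Signature) (A : Type) [SAlg S A] : Prop :=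
  ∃ (n : ℕ) (t : STerm S n) (u v : Fin n → Fin n → Fin 2),
    1 < n ∧ (∀ i, u i i ≠ v i i) ∧ TaylorOn S A t u v

/-- `A` and `B` lie in a common (locally finite, as they are finite) Taylor variety:
they share a common Taylor term with common Taylor identities. -/
def CommonTaylor (S : Signature) (A B : Type) [SAlg S A] [SAlg S B] : Prop :=
  ∃ (n : ℕ) (t : STerm S n) (u v : Fin n → Fin n → Fin 2),
    1 < n ∧ (∀ i, u i i ≠ v i i) ∧ TaylorOn S A t u v ∧ TaylorOn S B t u v

/-- The quotient of `A` by (the equivalence relation of) `θ`. -/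
abbrev ConQuot {A : Type} (θ : Set (A × A)) : Type :=
  Quot (fun a b => (a, b) ∈ θ)

/-- The class of `a` in `A/θ`. -/
def ConQuot.mk {A : Type} (θ : Set (A × A)) (a : A) : ConQuot θ :=
  Quot.mk _ a

/-- The quotient algebra structure on `A/θ` (extensionally correct when `θ` is a
congruence). -/
noncomputable def quotAlg {S : Signature} {A : Type} (iA : SAlg S A) (θ : Set (A × A)) :
    SAlg S (ConQuot θ) :=
  ⟨fun o x => ConQuot.mk θ
    (@SAlg.interp S A iA o fun i => Classical.choose (Quot.exists_rep (x i)))⟩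

/-- `f` is a homomorphism with respect to the given algebra structures. -/
def IsHomI {S : Signature} {A B : Type} (iA : SAlg S A) (iB : SAlg S B) (f : A → B) : Prop :=
  ∀ (o : S.ops) (x : Fin (S.arity o) → A),
    f (@SAlg.interp S A iA o x) = @SAlg.interp S B iB o fun i => f (x i)

/-- The two algebras are isomorphic. -/
def IsoAlgI {S : Signature} {A B : Type} (iA : SAlg S A) (iB : SAlg S B) : Prop :=
  ∃ f : A ≃ B, IsHomI iA iB f

/-- The identity bridge `I_{(A,ρ,L)}`. -/
def idBridge {A : Type} (ρ L : Set (A × A)) : Set (A × A × A × A) :=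
  {p | (p.1, p.2.1) ∈ L ∧ (p.2.2.1, p.2.2.2) ∈ L ∧ (p.1, p.2.2.1) ∈ ρ ∧ (p.2.1, p.2.2.2) ∈ ρ}

/-- Composition of quaternary relations (bridges). -/
def bComp {A B C : Type} (T : Set (A × A × B × B)) (T' : Set (B × B × C × C)) :
    Set (A × A × C × C) :=
  {p | ∃ b₁ b₂, (p.1, p.2.1, b₁, b₂) ∈ T ∧ (b₁, b₂, p.2.2.1, p.2.2.2) ∈ T'}

/-- Converse of a quaternary relation (bridge). -/
def bConv {A B : Type} (T : Set (A × A × B × B)) : Set (B × B × A × A) :=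
  {p | (p.2.2.1, p.2.2.2, p.1, p.2.1) ∈ T}

/-- `Δ♭_{θ,α}`: the congruence `Δ_{θ,α}` of `A(θ)` viewed as a quaternary relation. -/
def deltaFlat (S : Signature) {A : Type} [SAlg S A] (θ α : Set (A × A)) :
    Set (A × A × A × A) :=
  {p | ((p.1, p.2.1), (p.2.2.1, p.2.2.2)) ∈ DeltaCon S θ α}

/-- `T^opt_{(A,ρ)} = I_{(A,ρ,ρ⁺)} ∘ Δ♭_{ρ⁺,(ρ:ρ⁺)} ∘ I_{(A,ρ,ρ⁺)}`. -/
def Topt (S : Signature) {A : Type} [SAlg S A] (ρ ρplus : Set (A × A)) :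
    Set (A × A × A × A) :=
  bComp (idBridge ρ ρplus)
    (bComp (deltaFlat S ρplus (centralizer S ρ ρplus)) (idBridge ρ ρplus))

/-- `A` is subdirectly irreducible with monolith `μ`. -/
def IsMonolith (S : Signature) {A : Type} [SAlg S A] (μ : Set (A × A)) : Prop :=
  IsCongruence S μ ∧ μ ≠ diag A ∧ ∀ θ, IsCongruence S θ → θ ≠ diag A → μ ⊆ θ

/-- The carrier of `D(A,θ)`-style quotients: `A(μ)/Δ_{μ,α}`. -/
abbrev DCar (S : Signature) (A : Type) [SAlg S A] (μ α : Set (A × A)) : Type :=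
  Quot (fun p q : ↥μ => ((p : A × A), (q : A × A)) ∈ DeltaCon S μ α)

/-- The class of a pair `p ∈ μ` in `A(μ)/Δ_{μ,α}`. -/
def DCar.mk (S : Signature) (A : Type) [SAlg S A] (μ α : Set (A × A)) (p : ↥μ) :
    DCar S A μ α :=
  Quot.mk _ p

/-- The algebra structure on `A(μ)/Δ_{μ,α}` (extensionally correct when `μ` is a
congruence and `Δ_{μ,α}` is a congruence of `A(μ)`). -/
noncomputable def DAlg (S : Signature) (A : Type) [SAlg S A] (μ α : Set (A × A))
    (h : IsSubuniverse S μ) : SAlg S (DCar S A μ α) :=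
  letI := subAlg μ h
  ⟨fun o x => DCar.mk S A μ α
    (SAlg.interp o fun i => Classical.choose (Quot.exists_rep (x i)))⟩

/-- The canonical similarity bridge `T_{D(A)}` from `A` to `D(A)`. -/
def TDBridge (S : Signature) (A : Type) [SAlg S A] (μ α : Set (A × A)) :
    Set (A × A × DCar S A μ α × DCar S A μ α) :=
  {x | ∃ (a b e : A) (_ : (a, b) ∈ μ) (h1 : (a, e) ∈ μ) (h2 : (b, e) ∈ μ),
    x = (a, b, DCar.mk S A μ α ⟨(a, e), h1⟩, DCar.mk S A μ α ⟨(b, e), h2⟩)}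

/-- Similarity of (subdirectly irreducible) algebras: `D(A) ≅ D(B)`, where `D(X)` is
`X(μ)/Δ_{μ,(0:μ)}` if the monolith `μ` is abelian, and `X` itself otherwise. -/
def SimilarI (S : Signature) {A B : Type} (iA : SAlg S A) (iB : SAlg S B) : Prop :=
  letI := iA
  letI := iB
  ∃ (μA : Set (A × A)) (μB : Set (B × B)) (hA : IsMonolith S μA) (hB : IsMonolith S μB),
    ((Centralizes S μA μA (diag A) ∧ Centralizes S μB μB (diag B)) →
      IsoAlgI (DAlg S A μA (centralizer S (diag A) μA) hA.1.1)
        (DAlg S B μB (centralizer S (diag B) μB) hB.1.1)) ∧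
    ((Centralizes S μA μA (diag A) ∧ ¬ Centralizes S μB μB (diag B)) →
      IsoAlgI (DAlg S A μA (centralizer S (diag A) μA) hA.1.1) iB) ∧
    ((¬ Centralizes S μA μA (diag A) ∧ Centralizes S μB μB (diag B)) →
      IsoAlgI iA (DAlg S B μB (centralizer S (diag B) μB) hB.1.1)) ∧
    ((¬ Centralizes S μA μA (diag A) ∧ ¬ Centralizes S μB μB (diag B)) →
      IsoAlgI iA iB)

end Zhuk

namespace Zhuk

section TermOperations

variable {S : Signature}

/-- Simultaneous substitution of terms for variables. -/
def STerm.subst {n m : ℕ} : STerm S n → (Fin n → STerm S m) → STerm S m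
  | .var i, s => s i
  | .app o ts, s => .app o fun i => (ts i).subst s

theorem STerm.eval_subst {A : Type} [SAlg S A] {n m : ℕ} (t : STerm S n)
    (s : Fin n → STerm S m) (v : Fin m → A) :
    (t.subst s).eval v = t.eval fun i => (s i).eval v := by
  induction t with
  | var i => rfl
  | app o ts ih => simp only [STerm.subst, STerm.eval, ih]

theorem STerm.eval_rel {A B C : Type} [SAlg S A] [SAlg S B] [SAlg S C] {D : A → B → C → Prop}
    {n : ℕ} (t : STerm S n)
    (op : ∀ (f : S.ops) (a : Fin (S.arity f) → A) (b : Fin (S.arity f) → B)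
      (c : Fin (S.arity f) → C), (∀ i, D (a i) (b i) (c i)) →
      D (SAlg.interp f a) (SAlg.interp f b) (SAlg.interp f c))
    {a : Fin n → A} {b : Fin n → B} {c : Fin n → C} (h : ∀ i, D (a i) (b i) (c i)) :
    D (t.eval a) (t.eval b) (t.eval c) := by
  induction t with
  | var i => exact h i
  | app f ts ih => exact op f _ _ _ ih

theorem STerm.eval_rel₂ {A B C : Type} [SAlg S A] [SAlg S B] [SAlg S C] {D : A → B → C → Prop}
    (t : STerm S 2)
    (op : ∀ (f : S.ops) (a : Fin (S.arity f) → A) (b : Fin (S.arity f) → B)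
      (c : Fin (S.arity f) → C), (∀ i, D (a i) (b i) (c i)) →
      D (SAlg.interp f a) (SAlg.interp f b) (SAlg.interp f c))
    {a a' : A} {b b' : B} {c c' : C} (h : D a b c) (h' : D a' b' c') :
    D (t.eval ![a, a']) (t.eval ![b, b']) (t.eval ![c, c']) :=
  t.eval_rel op (by intro i; fin_cases i; exacts [h, h'])

variable {Z : Type} [SAlg S Z]

/-- `f` is a term operation. -/
def IsTermOp (S : Signature) {Z : Type} [SAlg S Z] {n : ℕ} (f : (Fin n → Z) → Z) : Prop :=
  ∃ t : STerm S n, ∀ v, t.eval v = f v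

/-- `f` is a binary term operation. -/
def IsTermOp₂ (S : Signature) {Z : Type} [SAlg S Z] (f : Z → Z → Z) : Prop :=
  IsTermOp S fun v : Fin 2 → Z => f (v 0) (v 1)

/-- `f` is a ternary term operation. -/
def IsTermOp₃ (S : Signature) {Z : Type} [SAlg S Z] (f : Z → Z → Z → Z) : Prop :=
  IsTermOp S fun v : Fin 3 → Z => f (v 0) (v 1) (v 2)

theorem IsTermOp.proj {n : ℕ} (i : Fin n) : IsTermOp S fun v : Fin n → Z => v i :=
  ⟨.var i, fun _ => rfl⟩

theorem IsTermOp.comp {n m : ℕ} {f : (Fin n → Z) → Z} (hf : IsTermOp S f)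
    {g : Fin n → (Fin m → Z) → Z} (hg : ∀ i, IsTermOp S (g i)) :
    IsTermOp S fun v => f fun i => g i v := by
  obtain ⟨t, ht⟩ := hf
  choose s hs using hg
  refine ⟨t.subst s, fun v => ?_⟩
  rw [STerm.eval_subst, ht]
  simp only [hs]

theorem IsTermOp₂.comp {m : ℕ} {f : Z → Z → Z} (hf : IsTermOp₂ S f)
    {g₁ g₂ : (Fin m → Z) → Z} (h₁ : IsTermOp S g₁) (h₂ : IsTermOp S g₂) :
    IsTermOp S fun v => f (g₁ v) (g₂ v) := by
  have := IsTermOp.comp hf (g := ![g₁, g₂]) (by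
    intro i; fin_cases i
    · exact h₁
    · exact h₂)
  exact this

theorem IsTermOp₃.comp {m : ℕ} {f : Z → Z → Z → Z} (hf : IsTermOp₃ S f)
    {g₁ g₂ g₃ : (Fin m → Z) → Z} (h₁ : IsTermOp S g₁) (h₂ : IsTermOp S g₂)
    (h₃ : IsTermOp S g₃) :
    IsTermOp S fun v => f (g₁ v) (g₂ v) (g₃ v) := by
  have := IsTermOp.comp hf (g := ![g₁, g₂, g₃]) (by
    intro i; fin_cases i
    · exact h₁
    · exact h₂
    · exact h₃)
  exact this

theorem IsTermOp₂.swap {f : Z → Z → Z} (hf : IsTermOp₂ S f) : IsTermOp₂ S fun x y => f y x :=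
  hf.comp (.proj 1) (.proj 0)

/-- `k`-fold iteration of a binary operation in its first variable. -/
def iter₂ (r : Z → Z → Z) (k : ℕ) (x y : Z) : Z := (fun u => r u y)^[k] x

theorem iter₂_succ (r : Z → Z → Z) (k : ℕ) (x y : Z) :
    iter₂ r (k + 1) x y = r (iter₂ r k x y) y :=
  Function.iterate_succ_apply' _ _ _

theorem iter₂_succ' (r : Z → Z → Z) (k : ℕ) (x y : Z) :
    iter₂ r (k + 1) x y = iter₂ r k (r x y) y :=
  Function.iterate_succ_apply _ _ _

theorem IsTermOp₂.iter {r : Z → Z → Z} (hr : IsTermOp₂ S r) (k : ℕ) :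
    IsTermOp₂ S (iter₂ r k) := by
  induction k with
  | zero => exact .proj 0
  | succ k ih =>
    have : iter₂ r (k + 1) = fun x y => r (iter₂ r k x y) y := by
      funext x y; exact iter₂_succ r k x y
    rw [this]
    exact hr.comp (ih.comp (.proj 0) (.proj 1)) (.proj 1)

theorem iter₂_self {r : Z → Z → Z} (h : ∀ z, r z z = z) (k : ℕ) (z : Z) :
    iter₂ r k z z = z :=
  Function.iterate_fixed (f := fun u => r u z) (h z) k

end TermOperations

theorem exists_min_image_nat {α : Sort*} (P : α → Prop) (f : α → ℕ) (h : ∃ a, P a) :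
    ∃ a, P a ∧ ∀ b, P b → f a ≤ f b := by
  classical
  have h' : ∃ n, ∃ a, P a ∧ f a = n := by
    obtain ⟨a, ha⟩ := h
    exact ⟨_, a, ha, rfl⟩
  obtain ⟨a, ha, hfa⟩ := Nat.find_spec h'
  exact ⟨a, ha, fun b hb => hfa ▸ Nat.find_min' h' ⟨b, hb, rfl⟩⟩

/-- A finite type has a positive exponent making every iterated self-map idempotent. -/
theorem exists_iterate_idempotent (A : Type) [Finite A] :
    ∃ N, 0 < N ∧ ∀ k, 0 < k → ∀ (f : A → A) (a : A), f^[N * k] (f^[N * k] a) = f^[N * k] a := by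
  classical
  have key : ∀ f : A → A, ∃ p, 0 < p ∧ ∀ k, 0 < k → f^[p * k + p * k] = f^[p * k] := by
    intro f
    obtain ⟨i, j, hij, he⟩ : ∃ i j : ℕ, i < j ∧ f^[i] = f^[j] := by
      obtain ⟨i, j, hne, he⟩ := Finite.exists_ne_map_eq_of_infinite fun n : ℕ => f^[n]
      rcases lt_or_gt_of_ne hne with h | h
      · exact ⟨i, j, h, he⟩
      · exact ⟨j, i, h, he.symm⟩
    obtain ⟨q, rfl⟩ := Nat.exists_eq_add_of_lt hij
    have step : ∀ n, i ≤ n → f^[n + (q + 1)] = f^[n] := by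
      intro n hn
      obtain ⟨m, rfl⟩ := Nat.exists_eq_add_of_le hn
      calc f^[i + m + (q + 1)] = f^[m + (i + q + 1)] := by congr 1; omega
        _ = f^[m] ∘ f^[i + q + 1] := Function.iterate_add _ _ _
        _ = f^[m] ∘ f^[i] := by rw [he]
        _ = f^[m + i] := (Function.iterate_add _ _ _).symm
        _ = f^[i + m] := by rw [add_comm]
    have steps : ∀ k n, i ≤ n → f^[n + (q + 1) * k] = f^[n] := by
      intro k
      induction k with
      | zero => intro n _; simp
      | succ k ih =>
        intro n hn
        rw [Nat.mul_succ, ← add_assoc, step _ (by omega), ih n hn]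
    refine ⟨(q + 1) * (i + 1), by positivity, fun k hk => ?_⟩
    have hle : i ≤ (q + 1) * (i + 1) * k := by nlinarith [Nat.mul_le_mul (Nat.mul_le_mul
      (Nat.succ_le_succ (Nat.zero_le q)) (le_refl (i + 1))) hk]
    have := steps ((i + 1) * k) _ hle
    rwa [← mul_assoc] at this
  choose p hp hpk using key
  have : Fintype (A → A) := Fintype.ofFinite _
  refine ⟨∏ f, p f, Finset.prod_pos fun f _ => hp f, fun k hk f a => ?_⟩
  obtain ⟨c, hc⟩ := Finset.dvd_prod_of_mem p (Finset.mem_univ f)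
  have hcpos : 0 < c := by
    rcases Nat.eq_zero_or_pos c with h | h
    · have := Finset.prod_pos (s := Finset.univ) fun (f : A → A) _ => hp f
      rw [hc, h] at this; simp at this
    · exact h
  rw [← Function.iterate_add_apply, hc, mul_assoc, hpk f (c * k) (by positivity)]

/-- The properties of the partial addition `R` with zero `o` induced on the quotient of `ρ*`
that force the quotient algebra to be affine; `N` is an idempotent exponent. -/
structure PartialSum (S : Signature) {Z : Type} [SAlg S Z] (R : Z → Z → Z → Prop) (o : Z)
    (N : ℕ) : Prop where
  op : ∀ (f : S.ops) (x y w : Fin (S.arity f) → Z), (∀ i, R (x i) (y i) (w i)) →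
    R (SAlg.interp f x) (SAlg.interp f y) (SAlg.interp f w)
  left : ∀ y w, R o y w → y = w
  zero_right : ∀ x, R x o x
  zero_left : ∀ x, R o x x
  zero : ∀ f : S.ops, SAlg.interp f (fun _ => (o : Z)) = o
  gen : ∀ B : Set Z, IsSubuniverse S B → o ∈ B → ∀ z ∈ B, z ≠ o → B = Set.univ
  pos : 0 < N
  idem : ∀ (f : Z → Z) (z : Z), f^[N] (f^[N] z) = f^[N] z
  law : ∀ r : Z → Z → Z, IsTermOp₂ S r → (∀ z, r z z = z) →
    ∀ x y z, iter₂ r N (iter₂ r N x y) z = iter₂ r N x z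

/-- The two absorption laws of a rectangular band. -/
structure IsBand {Z : Type} (E : Z → Z → Z) : Prop where
  left : ∀ x y z, E (E x y) z = E x z
  right : ∀ x y z, E x (E y z) = E x z

/-- The band obtained by iterating a binary operation, first in one variable and then in the
other. -/
def iterBand {Z : Type} (r : Z → Z → Z) (N : ℕ) (x y : Z) : Z :=
  iter₂ (fun u v => iter₂ r N v u) N y x

namespace PartialSum

variable {S : Signature} {Z : Type} [SAlg S Z] {R : Z → Z → Z → Prop} {o : Z} {N : ℕ}

section

variable (hC : PartialSum S R o N)
include hC

theorem pres {n : ℕ} {f : (Fin n → Z) → Z} (hf : IsTermOp S f) {x y w : Fin n → Z}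
    (h : ∀ i, R (x i) (y i) (w i)) : R (f x) (f y) (f w) := by
  obtain ⟨t, ht⟩ := hf
  simpa only [ht] using t.eval_rel hC.op h

theorem pres₂ {r : Z → Z → Z} (hr : IsTermOp₂ S r) {a b c a' b' c' : Z} (h : R a b c)
    (h' : R a' b' c') : R (r a a') (r b b') (r c c') := by
  have := hC.pres hr (x := ![a, a']) (y := ![b, b']) (w := ![c, c'])
    (by intro i; fin_cases i; exacts [h, h'])
  exact this

theorem pres₃ {q : Z → Z → Z → Z} (hq : IsTermOp₃ S q) {a b c a' b' c' a'' b'' c'' : Z}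
    (h : R a b c) (h' : R a' b' c') (h'' : R a'' b'' c'') :
    R (q a a' a'') (q b b' b'') (q c c' c'') := by
  have := hC.pres hq (x := ![a, a', a'']) (y := ![b, b', b'']) (w := ![c, c', c''])
    (by intro i; fin_cases i; exacts [h, h', h''])
  exact this

theorem eval_zero {n : ℕ} (t : STerm S n) : (t.eval fun _ => o) = o := by
  induction t with
  | var i => rfl
  | app f ts ih => simp only [STerm.eval, ih, hC.zero]

theorem exists_term {z : Z} (hz : z ≠ o) (w : Z) :
    ∃ t : Z → Z → Z, IsTermOp₂ S t ∧ t z o = w ∧ t o o = o := by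
  have hB : IsSubuniverse S {w : Z | ∃ t : STerm S 2, t.eval ![z, o] = w} := by
    intro f x hx
    choose t ht using hx
    exact ⟨.app f t, by simp only [STerm.eval, ht]⟩
  have huniv := hC.gen _ hB ⟨.var 1, rfl⟩ z ⟨.var 0, rfl⟩ hz
  obtain ⟨t, ht⟩ : w ∈ {w : Z | ∃ t : STerm S 2, t.eval ![z, o] = w} := huniv ▸ Set.mem_univ w
  refine ⟨fun x y => t.eval ![x, y], ⟨t, fun v => ?_⟩, ht, ?_⟩
  · congr 1
    funext i
    fin_cases i <;> rfl
  · rw [← hC.eval_zero t]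
    simp only
    congr 1
    funext i
    fin_cases i <;> simp [hC.eval_zero t]

end

theorem iterBand_termOp {r : Z → Z → Z} (hr : IsTermOp₂ S r) (N : ℕ) :
    IsTermOp₂ S (iterBand r N) :=
  ((hr.iter N).swap.iter N).swap

theorem iterBand_self {r : Z → Z → Z} (h : ∀ z, r z z = z) (N : ℕ) (z : Z) :
    iterBand r N z z = z :=
  iter₂_self (r := fun u v => iter₂ r N v u) (fun z => iter₂_self h N z) N z

theorem iterBand_absorb {r : Z → Z → Z} {α : Type} (g : Z → α)
    (hg : ∀ y z, g (iter₂ r N y z) = g z) (y z : Z) : g (iterBand r N y z) = g z := by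
  suffices ∀ k, g (iter₂ (fun u v => iter₂ r N v u) k z y) = g z from this N
  intro k
  induction k with
  | zero => rfl
  | succ k ih => rw [iter₂_succ, hg, ih]

theorem iterBand_congr {r : Z → Z → Z} {x x' : Z}
    (h : ∀ u, iter₂ r N x u = iter₂ r N x' u) (y : Z) : iterBand r N x y = iterBand r N x' y := by
  simp only [iterBand, iter₂] at h ⊢
  simp only [h]

section

variable (hC : PartialSum S R o N)
include hC

theorem iterBand_eq_iter (r : Z → Z → Z) (x y : Z) :
    ∃ u, iterBand r N x y = iter₂ r N x u := by
  obtain ⟨M, rfl⟩ := Nat.exists_eq_succ_of_ne_zero hC.pos.ne'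
  exact ⟨_, iter₂_succ _ _ _ _⟩

theorem iterBand_iter {r : Z → Z → Z} (hr : IsTermOp₂ S r) (hi : ∀ z, r z z = z) (x y z : Z) :
    iterBand r N (iter₂ r N x y) z = iterBand r N x z :=
  iterBand_congr (hC.law r hr hi x y) z

theorem iter_iterBand {r : Z → Z → Z} (hr : IsTermOp₂ S r) (hi : ∀ z, r z z = z) (x y z : Z) :
    iter₂ r N (iterBand r N x y) z = iter₂ r N x z := by
  obtain ⟨u, hu⟩ := hC.iterBand_eq_iter r x y
  rw [hu, hC.law r hr hi]

theorem isBand_iterBand {r : Z → Z → Z} (hr : IsTermOp₂ S r) (hi : ∀ z, r z z = z) :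
    IsBand (iterBand r N) where
  left x y z := by
    obtain ⟨u, hu⟩ := hC.iterBand_eq_iter r x y
    rw [hu, hC.iterBand_iter hr hi]
  right x y z := hC.law _ (hr.iter N).swap (fun z => iter₂_self hi N z) z y x

theorem iterBand_ne {r : Z → Z → Z} (hr : IsTermOp₂ S r) (hi : ∀ z, r z z = z) {z : Z}
    (hz : iter₂ r N z o ≠ o) : iterBand r N z o ≠ o := fun h => hz <| by
  rw [← hC.iter_iterBand hr hi z o, h, iter₂_self hi]

end

/-- Modulo the band `E`, the operation `r` is the first projection. -/
def Retains (E r : Z → Z → Z) : Prop := ∀ x y z, E (r (E x y) y) z = E x z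

/-- The bands that are compatible with `H` and nontrivial. -/
structure Refines (S : Signature) {Z : Type} [SAlg S Z] (H : Z → Z → Z) (o : Z)
    (E : Z → Z → Z) : Prop where
  termOp : IsTermOp₂ S E
  self : ∀ z, E z z = z
  band : IsBand E
  absorb_left : ∀ x y z, E (H x y) z = E x z
  absorb_right : ∀ x y z, H x (E y z) = H x z
  nonzero : ∃ z, E z o ≠ o

section

variable (hC : PartialSum S R o N)
include hC

section

variable {H : Z → Z → Z} (hH : IsTermOp₂ S H)
  (hG : ∀ q, IsTermOp₃ S q → (∀ w x, q w x x = w) → ∀ z, H (q o z o) o = o)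
include hH hG

theorem ternary_absorb {q : Z → Z → Z → Z} (hq : IsTermOp₃ S q) (hqi : ∀ w x, q w x x = w)
    (w z y v : Z) : H (q w z y) v = H w v := by
  have key : ∀ z, H (q w o y) v = H (q w z y) v := fun z => by
    have h := hC.pres₂ hH (hC.pres₃ hq (hC.zero_left w) (hC.zero_right z) (hC.zero_left y))
      (hC.zero_left v)
    rw [hG q hq hqi] at h
    exact hC.left _ _ h
  rw [← key z, key y, hqi]

theorem absorb_of_injective {r : Z → Z → Z} (hr : IsTermOp₂ S r) (hi : ∀ z, r z z = z)
    (hinj : Function.Injective fun x => r x o) (x y v : Z) : H (r x y) v = H x v := by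
  have hF : ∀ x y, iter₂ r N x y = x := fun x y =>
    hinj.iterate N (hC.law r hr hi x y o)
  obtain ⟨M, rfl⟩ := Nat.exists_eq_succ_of_ne_zero hC.pos.ne'
  have h := hC.ternary_absorb hH hG (q := fun w x y => iter₂ r M (r w x) y)
    ((hr.iter M).comp (hr.comp (.proj 0) (.proj 1)) (.proj 2))
    (fun w x => by rw [← iter₂_succ', hF]) x y (r x y) v
  simpa only [iter₂_self hi] using h

end

theorem retains_eq {E r : Z → Z → Z} (hE : IsTermOp₂ S E) (hEi : ∀ z, E z z = z)
    (hEb : IsBand E) (hr : IsTermOp₂ S r) (h : Retains E r) {u w : Z} (hu : E u o = u)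
    (hw : E w o = w) : E (r u w) o = u := by
  have how : E o w = o := by rw [← hw, hEb.right, hEi]
  have h₁ : E (r o w) o = o := by
    have := h o w o
    rwa [how, hEi] at this
  have h₂ : E (r u o) o = u := by
    have := h u o o
    rwa [hu] at this
  have h₃ := hC.pres₂ hE (hC.pres₂ hr (hC.zero_left u) (hC.zero_right w)) (hC.zero_right o)
  rw [h₁, h₂] at h₃
  exact (hC.left _ _ h₃).symm

/-- Among the compatible bands choose one of minimal image: then every idempotent binary term
operation or its opposite is the first projection modulo that band. -/
theorem exists_refines_retains [Finite Z] {H : Z → Z → Z} (hH : IsTermOp₂ S H)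
    (hHi : ∀ z, H z z = z) (hHb : IsBand H) (hHo : ∃ z, H z o ≠ o)
    (hG : ∀ q, IsTermOp₃ S q → (∀ w x, q w x x = w) → ∀ z, H (q o z o) o = o) :
    ∃ E, Refines S H o E ∧ ∀ r, IsTermOp₂ S r → (∀ z, r z z = z) →
      Retains E r ∨ Retains E fun x y => r y x := by
  obtain ⟨E, hE, hmin⟩ := exists_min_image_nat (Refines S H o)
    (fun E => (Set.range fun x => E x o).ncard) ⟨H, hH, hHi, hHb, hHb.left, hHb.right, hHo⟩
  refine ⟨E, hE, ?_⟩
  have key : ∀ r, IsTermOp₂ S r → (∀ z, r z z = z) →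
      Retains E r ∨ ∀ z, (fun u => E (r (E u o) o) o)^[N] z = o := by
    intro r hr hi
    rw [or_iff_not_imp_right]
    intro hz
    push Not at hz
    obtain ⟨z, hz⟩ := hz
    set r' : Z → Z → Z := fun x y => E (r (E x y) y) y with hr'
    have hr't : IsTermOp₂ S r' :=
      hE.termOp.comp (hr.comp (hE.termOp.comp (.proj 0) (.proj 1)) (.proj 1)) (.proj 1)
    have hr'i : ∀ z, r' z z = z := fun z => by simp only [hr', hE.self, hi]
    have hz' : iter₂ r' N z o ≠ o := hz
    obtain ⟨M, hM⟩ := Nat.exists_eq_succ_of_ne_zero hC.pos.ne'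
    have hE₁l : ∀ x y w, iter₂ r' N (H x y) w = iter₂ r' N x w := by
      intro x y w
      rw [hM, iter₂_succ', iter₂_succ']
      simp only [hr', hE.absorb_left]
    have hE₁r : ∀ x y w, H x (iter₂ r' N y w) = H x w := by
      intro x y w
      rw [hM, iter₂_succ]
      exact hE.absorb_right _ _ _
    have hE₂ : Refines S H o (iterBand r' N) :=
      ⟨iterBand_termOp hr't N, iterBand_self hr'i N, hC.isBand_iterBand hr't hr'i,
        fun x y w => iterBand_congr (hE₁l x y) w,
        fun x y w => iterBand_absorb (H x) (hE₁r x) y w, z, hC.iterBand_ne hr't hr'i hz'⟩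
    have hsub : (Set.range fun x => iter₂ r' N x o) ⊆ Set.range fun x => E x o := by
      rintro _ ⟨x, rfl⟩
      refine ⟨r (E (iter₂ r' M x o) o) o, ?_⟩
      simp only
      rw [hM, iter₂_succ]
    have himg : (Set.range fun x => iterBand r' N x o) =
        (fun x => iterBand r' N x o) '' Set.range fun x => iter₂ r' N x o := by
      rw [← Set.range_comp]
      congr 1
      funext x
      exact (hC.iterBand_iter hr't hr'i x o o).symm
    have hle : (Set.range fun x => E x o).ncard ≤ (Set.range fun x => iter₂ r' N x o).ncard := by
      refine (hmin _ hE₂).trans ?_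
      rw [himg]
      exact Set.ncard_image_le (Set.toFinite _)
    have heq := Set.eq_of_subset_of_ncard_le hsub hle (Set.toFinite _)
    have hfix : ∀ x, iter₂ r' N (E x o) o = E x o := by
      intro x
      obtain ⟨y, hy⟩ : E x o ∈ Set.range fun x => iter₂ r' N x o := heq ▸ ⟨x, rfl⟩
      rw [← hy]
      exact hC.law r' hr't hr'i y o o
    have hinj : ∀ x y, r' (E x o) o = r' (E y o) o → E x o = E y o := by
      intro x y h
      rw [← hfix x, ← hfix y, hM, iter₂_succ', iter₂_succ', h]
    have habs := hC.absorb_of_injective hH hG (r := fun x y => E (r (E x y) y) x)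
      (hE.termOp.comp (hr.comp (hE.termOp.comp (.proj 0) (.proj 1)) (.proj 1)) (.proj 0))
      (fun z => by simp only [hE.self, hi]) (by
        intro x y h
        simp only at h
        have h₁ : E x o = E y o := by
          apply hinj
          have := congrArg (fun u => E u o) h
          simpa only [hr', hE.band.left] using this
        have h₂ : E o x = E o y := by
          have := congrArg (fun u => E o u) h
          simpa only [hE.band.right] using this
        calc x = E (E x o) (E o x) := by rw [hE.band.left, hE.band.right, hE.self]
          _ = E (E y o) (E o y) := by rw [h₁, h₂]
          _ = y := by rw [hE.band.left, hE.band.right, hE.self])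
    intro x y w
    have h := congrArg (fun u => E u w) (habs x y o)
    simpa only [hE.absorb_left, hE.band.left] using h
  intro r hr hi
  by_contra hcon
  push Not at hcon
  have h₁ := (key r hr hi).resolve_left hcon.1
  have h₂ := (key _ hr.swap hi).resolve_left hcon.2
  obtain ⟨z, hz⟩ := hE.nonzero
  obtain ⟨u, hu, huo, hru⟩ : ∃ u, E u o = u ∧ u ≠ o ∧ E (r (E u o) o) o = o := by
    by_contra hno
    push Not at hno
    have : ∀ k, E ((fun u => E (r (E u o) o) o)^[k] (E z o)) o =
        (fun u => E (r (E u o) o) o)^[k] (E z o) ∧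
        (fun u => E (r (E u o) o) o)^[k] (E z o) ≠ o := by
      intro k
      induction k with
      | zero => exact ⟨hE.band.left _ _ _, hz⟩
      | succ k ih =>
        rw [Function.iterate_succ_apply']
        exact ⟨hE.band.left _ _ _, hno _ ih.1 ih.2⟩
    exact (this N).2 (h₁ _)
  have h₃ := hC.pres₂ hE.termOp (hC.pres₂ hr (hC.zero_right u) (hC.zero_left u))
    (hC.zero_right o)
  rw [hu] at hru
  rw [hru, hi, hu] at h₃
  have h₄ : E (r o (E u o)) o = u := by rw [hu]; exact hC.left _ _ h₃
  have h₅ := Function.iterate_fixed (f := fun u => E (r o (E u o)) o) h₄ N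
  exact huo (h₅.symm.trans (h₂ u))

end

end PartialSum

/-- The binary operation obtained from `f` by identifying the variables in `J` and those
outside `J`. -/
def minor₂ {Z : Type} {n : ℕ} (f : (Fin n → Z) → Z) (J : Finset (Fin n)) (x y : Z) : Z :=
  f fun j => if j ∈ J then x else y

/-- A Taylor operation: idempotent, and satisfying in each variable an identity that is not
satisfied by the corresponding projection. -/
structure IsTaylorOp {Z : Type} {n : ℕ} (f : (Fin n → Z) → Z) (u v : Fin n → Fin n → Fin 2) :
    Prop where
  self : ∀ z, f (fun _ => z) = z
  ne : ∀ i, u i i ≠ v i i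
  eq : ∀ i x y, f (fun j => if u i j = 0 then x else y) = f fun j => if v i j = 0 then x else y

namespace PartialSum

variable {S : Signature} {Z : Type} [SAlg S Z] {R : Z → Z → Z → Prop} {o : Z} {N : ℕ}

theorem minor₂_termOp {n : ℕ} {f : (Fin n → Z) → Z} (hf : IsTermOp S f) (J : Finset (Fin n)) :
    IsTermOp₂ S (minor₂ f J) := by
  refine hf.comp (g := fun j (v : Fin 2 → Z) => if j ∈ J then v 0 else v 1) fun j => ?_
  split_ifs
  exacts [.proj 0, .proj 1]

variable (hC : PartialSum S R o N)
include hC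

theorem exists_ternary [Finite Z] {n : ℕ} {f : (Fin n → Z) → Z} (hf : IsTermOp S f)
    {u v : Fin n → Fin n → Fin 2} (hT : IsTaylorOp f u v) {H : Z → Z → Z} (hH : IsTermOp₂ S H)
    (hHi : ∀ z, H z z = z) (hHb : IsBand H) (hHo : ∃ z, H z o ≠ o) :
    ∃ q : Z → Z → Z → Z, IsTermOp₃ S q ∧ (∀ w x, q w x x = w) ∧ ∃ z, H (q o z o) o ≠ o := by
  by_contra hcon
  have hG : ∀ q, IsTermOp₃ S q → (∀ w x, q w x x = w) → ∀ z, H (q o z o) o = o := by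
    intro q hq hqi z
    by_contra hz
    exact hcon ⟨q, hq, hqi, z, hz⟩
  clear hcon
  obtain ⟨E, hE, hret⟩ := hC.exists_refines_retains hH hHi hHb hHo hG
  obtain ⟨z₀, hz₀⟩ := hE.nonzero
  obtain ⟨a, ha, hao⟩ : ∃ a, E a o = a ∧ a ≠ o := ⟨E z₀ o, hE.band.left _ _ _, hz₀⟩
  have hself : ∀ J z, minor₂ f J z z = z := fun J z => by
    simp only [minor₂, ite_self, hT.self]
  have hdich : ∀ J, Retains E (minor₂ f J) ∨ Retains E fun x y => minor₂ f J y x :=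
    fun J => hret _ (minor₂_termOp hf J) (hself J)
  have hval : ∀ {r : Z → Z → Z}, IsTermOp₂ S r → Retains E r → ∀ {x y}, E x o = x → E y o = y →
      E (r x y) o = x :=
    fun hr h _ _ => hC.retains_eq hE.termOp hE.self hE.band hr h
  have hoo : E o o = o := hE.self o
  have hswap : ∀ J, (fun x y => minor₂ f J y x) = minor₂ f Jᶜ := by
    intro J
    funext x y
    simp only [minor₂, Finset.mem_compl]
    congr 1
    funext j
    by_cases h : j ∈ J <;> simp [h]
  obtain ⟨i, hi⟩ : ∃ i, Retains E (minor₂ f {i}) := by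
    by_contra hno
    push Not at hno
    have hall : ∀ J, E (minor₂ f J a o) o = o := by
      intro J
      induction J using Finset.induction_on with
      | empty => simp only [minor₂, Finset.notMem_empty, if_false, hT.self, hoo]
      | insert i J hiJ ih =>
        have h₁ := hval (minor₂_termOp hf {i}).swap ((hdich {i}).resolve_left (hno i)) hoo ha
        have h₂ := hC.pres hf (x := fun j => if j ∈ ({i} : Finset _) then a else o)
          (y := fun j => if j ∈ J then a else o)
          (w := fun j => if j ∈ insert i J then a else o) (by
            intro j
            by_cases hj : j = i
            · subst hj; simpa [hiJ] using hC.zero_right a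
            · by_cases hj' : j ∈ J
              · simpa [hj, hj'] using hC.zero_left a
              · simpa [hj, hj'] using hC.zero_left o)
        have h₃ := hC.pres₂ hE.termOp h₂ (hC.zero_right o)
        simp only [minor₂] at h₁ ih ⊢
        rw [h₁, ih] at h₃
        exact (hC.left _ _ h₃).symm
    have := hall Finset.univ
    simp only [minor₂, Finset.mem_univ, if_true, hT.self, ha] at this
    exact hao this
  have hnot : ∀ K, i ∉ K → ¬ Retains E (minor₂ f K) := by
    intro K hiK hK
    set p : Z → Z → Z → Z := fun x y w => f fun j => if j = i then x else if j ∈ K then y else w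
      with hp
    have hpt : IsTermOp₃ S p := by
      refine hf.comp (g := fun j (v : Fin 3 → Z) => if j = i then v 0 else
        if j ∈ K then v 1 else v 2) fun j => ?_
      split_ifs
      exacts [.proj 0, .proj 1, .proj 2]
    have hpi : ∀ x, p x x x = x := fun x => by simp only [hp, ite_self, hT.self]
    have hp₁ : minor₂ f {i} = fun x y => p x y y := by
      funext x y
      simp only [minor₂, hp, Finset.mem_singleton, ite_self]
    have hp₂ : minor₂ f K = fun x y => p y x y := by
      funext x y
      simp only [minor₂, hp]
      congr 1
      funext j
      by_cases h : j = i
      · subst h; simp [hiK]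
      · simp [h]
    have hp₃ : minor₂ f (insert i K) = fun x y => p x x y := by
      funext x y
      simp only [minor₂, hp]
      congr 1
      funext j
      by_cases h : j = i <;> simp [h]
    have hd := hdich (insert i K)
    have hr₁ := minor₂_termOp hf {i}
    have hr₂ := minor₂_termOp hf K
    have hr₃ := minor₂_termOp hf (insert i K)
    rw [hp₁] at hi hr₁
    rw [hp₂] at hK hr₂
    rw [hp₃] at hd hr₃
    rcases hd with hd | hd
    · have h₁ := hval hr₃ hd hoo ha
      have h₂ := hval hr₁ hi hoo ha
      have h₃ := hval hr₂ hK ha hoo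
      have h₄ := hC.pres₂ hE.termOp
        (hC.pres₃ hpt (hC.zero_left o) (hC.zero_left a) (hC.zero_right a)) (hC.zero_right o)
      rw [h₁, h₂, h₃] at h₄
      exact hao (hC.left _ _ h₄)
    · have h₁ := hG (fun w x y => E (p (E x y) y (E w y)) w)
        (hE.termOp.comp (hpt.comp (hE.termOp.comp (.proj 1) (.proj 2)) (.proj 2)
          (hE.termOp.comp (.proj 0) (.proj 2))) (.proj 0))
        (fun w x => by
          have := hd w x w
          simp only at this
          rw [hE.self, this, hE.self]) z₀
      have h₂ := hi z₀ o o
      simp only at h₁ h₂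
      rw [hoo, h₂] at h₁
      have h₃ := hE.absorb_left (E z₀ o) o o
      rw [h₁, hoo, hE.band.left] at h₃
      exact hz₀ h₃.symm
  have hmem : ∀ J, i ∈ J → Retains E (minor₂ f J) := by
    intro J hiJ
    have := (hdich Jᶜ).resolve_left (hnot _ (by simpa using hiJ))
    rwa [hswap, compl_compl] at this
  have hfin : ∀ s t : Fin n → Fin 2, s i = 0 → t i ≠ 0 →
      f (fun j => if s j = 0 then a else o) = f (fun j => if t j = 0 then a else o) → False := by
    intro s t hs ht hst
    have h₁ := hval (minor₂_termOp hf _) (hmem (Finset.univ.filter fun j => s j = 0)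
      (by simpa using hs)) ha hoo
    have h₂ := hval (minor₂_termOp hf _) (hmem (Finset.univ.filter fun j => t j ≠ 0)
      (by simpa using ht)) hoo ha
    simp only [minor₂, Finset.mem_filter, Finset.mem_univ, true_and] at h₁ h₂
    simp only [ne_eq, ite_not] at h₂
    rw [hst, h₂] at h₁
    exact hao h₁.symm
  by_cases h : u i i = 0
  · exact hfin (u i) (v i) h (fun h' => hT.ne i (h.trans h'.symm)) (hT.eq i a o)
  · refine hfin (v i) (u i) ?_ h (hT.eq i a o).symm
    have := hT.ne i
    omega

theorem cancel {q : Z → Z → Z → Z} (hq : IsTermOp₃ S q) (hqi : ∀ w x, q w x x = w)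
    (hqo : ∃ z, q o z o ≠ o) {x v : Z} (h : R x v x) : v = o := by
  by_contra hv
  obtain ⟨z, hz⟩ := hqo
  obtain ⟨t, ht, htv, hto⟩ := hC.exists_term hv z
  have h₁ := hC.pres₃ hq (hC.zero_left o) (hC.pres₂ ht h (hC.zero_right x))
    (hC.pres₂ ht (hC.zero_right x) (hC.zero_right x))
  rw [hqi, htv, hto] at h₁
  exact hz (hC.left _ _ h₁)

theorem exists_ternary_zero [Finite Z] {n : ℕ} {f : (Fin n → Z) → Z} (hf : IsTermOp S f)
    {u v : Fin n → Fin n → Fin 2} (hT : IsTaylorOp f u v) :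
    ∃ q : Z → Z → Z → Z, IsTermOp₃ S q ∧ (∀ w x, q w x x = w) ∧ ∀ z, q z o z = o := by
  obtain ⟨q, ⟨hq, hqi⟩, hmin⟩ := exists_min_image_nat
    (fun q : Z → Z → Z → Z => IsTermOp₃ S q ∧ ∀ w x, q w x x = w)
    (fun q => (Set.range fun z => q z o z).ncard) ⟨fun w _ _ => w, .proj 0, fun _ _ => rfl⟩
  have hiter : ∀ k, 0 < k → ∃ q', (IsTermOp₃ S q' ∧ ∀ w x, q' w x x = w) ∧
      ∀ z, q' z o z = (fun z => q z o z)^[k] z := by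
    intro k hk
    induction k, hk using Nat.le_induction with
    | base => exact ⟨q, ⟨hq, hqi⟩, fun _ => rfl⟩
    | succ k hk ih =>
      obtain ⟨q', ⟨hq', hqi'⟩, hqz'⟩ := ih
      refine ⟨fun w x y => q (q' w x y) x (q' y x y), ⟨hq.comp (hq'.comp (.proj 0) (.proj 1)
        (.proj 2)) (.proj 1) (hq'.comp (.proj 2) (.proj 1) (.proj 2)), fun w x => ?_⟩, fun z => ?_⟩
      · simp only [hqi, hqi']
      · simp only [hqz', Function.iterate_succ_apply']
  obtain ⟨q₂, ⟨hq₂, hqi₂⟩, hqz₂⟩ := hiter N hC.pos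
  by_cases hz : ∀ z, q₂ z o z = o
  · exact ⟨q₂, hq₂, hqi₂, hz⟩
  exfalso
  push Not at hz
  obtain ⟨z, hz⟩ := hz
  set r : Z → Z → Z := fun x y => q x y x with hr
  have hrt : IsTermOp₂ S r := hq.comp (.proj 0) (.proj 1) (.proj 0)
  have hri : ∀ z, r z z = z := fun z => hqi z z
  have hro : ∀ x, iter₂ r N x o = q₂ x o x := fun x => (hqz₂ x).symm
  have hb := iterBand_self hri N
  obtain ⟨q₁, hq₁, hqi₁, z₁, hz₁⟩ := hC.exists_ternary hf hT (iterBand_termOp hrt N) hb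
    (hC.isBand_iterBand hrt hri) ⟨z, hC.iterBand_ne hrt hri (by rwa [hro])⟩
  have hq₁o : ∃ z, q₁ o z o ≠ o := ⟨z₁, fun h => hz₁ (by rw [h, hb])⟩
  set y := iter₂ r N (q₁ o z₁ o) o with hy
  have hyo : y ≠ o := by
    intro h
    apply hz₁
    rw [← hC.iterBand_iter hrt hri _ o o, ← hy, h, hb]
  obtain ⟨t, ht, hty, hto⟩ := hC.exists_term hyo z₁
  set q' : Z → Z → Z → Z := fun w x x' => iter₂ r N (q₁ w (t x w) (t x' w)) w with hq'
  have hq't : IsTermOp₃ S q' := (hrt.iter N).comp (hq₁.comp (.proj 0)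
    (ht.comp (.proj 1) (.proj 0)) (ht.comp (.proj 2) (.proj 0))) (.proj 0)
  have hq'i : ∀ w x, q' w x x = w := fun w x => by
    simp only [hq', hqi₁, iter₂_self hri]
  have hq'y : q' o y o = y := by simp only [hq', hty, hto, ← hy]
  have hq'o : q' y o y = o := by
    have h := hC.pres₃ hq't (hC.zero_left y) (hC.zero_right y) (hC.zero_left y)
    rw [hq'i, hq'y] at h
    exact hC.cancel hq₁ hqi₁ hq₁o h
  have hle := hmin (fun w x x' => q' (q₂ w x x') x (q₂ x' x x'))
    ⟨hq't.comp (hq₂.comp (.proj 0) (.proj 1) (.proj 2)) (.proj 1)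
      (hq₂.comp (.proj 2) (.proj 1) (.proj 2)), fun w x => by simp only [hqi₂, hq'i]⟩
  have hrange : (Set.range fun z => q' (q₂ z o z) o (q₂ z o z)) =
      (fun z => q' z o z) '' Set.range fun z => q₂ z o z := by
    rw [← Set.range_comp]
    rfl
  have hsub : (Set.range fun z => q₂ z o z) ⊆ Set.range fun z => q z o z := by
    obtain ⟨M, hM⟩ := Nat.exists_eq_succ_of_ne_zero hC.pos.ne'
    rintro _ ⟨x, rfl⟩
    refine ⟨(fun z => q z o z)^[M] x, ?_⟩
    simp only [hqz₂, hM, Function.iterate_succ_apply']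
  simp only [hrange] at hle
  have hinj := Set.injOn_of_ncard_image_eq (le_antisymm (Set.ncard_image_le (Set.toFinite _))
    ((Set.ncard_le_ncard hsub (Set.toFinite _)).trans hle)) (Set.toFinite _)
  refine hyo (hinj ⟨q₁ o z₁ o, (hro _).symm⟩ ⟨o, hqi₂ o o⟩ ?_)
  change q' y o y = q' o o o
  rw [hq'o, hq'i]

theorem exists_maltsev [Finite Z] {n : ℕ} {f : (Fin n → Z) → Z} (hf : IsTermOp S f)
    {u v : Fin n → Fin n → Fin 2} (hT : IsTaylorOp f u v) :
    ∃ p : Z → Z → Z → Z, IsTermOp₃ S p ∧ (∀ x z, p x x z = z) ∧ ∀ x z, p x z z = x := by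
  obtain ⟨q, hq, hqi, hqo⟩ := hC.exists_ternary_zero hf hT
  refine ⟨fun x y z => q z x y, hq.comp (.proj 2) (.proj 0) (.proj 1), fun x z => hqi z x,
    fun x z => ?_⟩
  have h₁ := hC.pres₃ hq (hC.zero_right z) (hC.zero_left x) (hC.zero_right z)
  have h₂ := hC.pres₃ hq (hC.zero_right x) (hC.zero_left x) (hC.zero_right x)
  rw [hqo] at h₁ h₂
  exact (hC.left _ _ h₁).symm.trans ((hC.left _ _ h₂).trans (hqi x x))

section

variable {p : Z → Z → Z → Z} (hp : IsTermOp₃ S p) (hpl : ∀ x z, p x x z = z)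
  (hpr : ∀ x z, p x z z = x) (hnt : ∃ z : Z, z ≠ o)
  (hsimp : ∀ θ : Set (Z × Z), IsCongruence S θ → θ = diag Z ∨ θ = Set.univ)
include hp hpl hpr hnt hsimp

theorem functional {x y w w' : Z} (h : R x y w) (h' : R x y w') : w = w' := by
  have hc : IsCongruence S {e : Z × Z | ∃ x y, R x y e.1 ∧ R x y e.2} := by
    refine ⟨fun g e he => ?_, ⟨fun x => ⟨o, x, hC.zero_left x, hC.zero_left x⟩, ?_, ?_⟩⟩
    · choose x y h₁ h₂ using he
      exact ⟨_, _, hC.op g _ _ _ h₁, hC.op g _ _ _ h₂⟩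
    · rintro _ _ ⟨x, y, h₁, h₂⟩
      exact ⟨x, y, h₂, h₁⟩
    · rintro a b c ⟨x, y, h₁, h₂⟩ ⟨x', y', h₃, h₄⟩
      refine ⟨p x x' x', p y y' y', ?_, ?_⟩
      · simpa only [hpr] using hC.pres₃ hp h₁ h₃ h₃
      · simpa only [hpl] using hC.pres₃ hp h₂ h₃ h₄
  rcases hsimp _ hc with hd | hd
  · have : (w, w') ∈ {e : Z × Z | ∃ x y, R x y e.1 ∧ R x y e.2} := ⟨x, y, h, h'⟩
    rw [hd] at this
    exact this
  · exfalso
    obtain ⟨z, hz⟩ := hnt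
    obtain ⟨x, y, h₁, h₂⟩ : (z, o) ∈ {e : Z × Z | ∃ x y, R x y e.1 ∧ R x y e.2} :=
      hd ▸ Set.mem_univ _
    have h₃ := hC.pres₃ hp h₁ h₂ (hC.zero_right o)
    rw [hpl, hpl, hpr] at h₃
    exact hz (hC.left _ _ h₃).symm

theorem injective {x y y' w : Z} (h : R x y w) (h' : R x y' w) : y = y' := by
  have hc : IsCongruence S {e : Z × Z | ∃ x w, R x e.1 w ∧ R x e.2 w} := by
    refine ⟨fun g e he => ?_, ⟨fun x => ⟨o, x, hC.zero_left x, hC.zero_left x⟩, ?_, ?_⟩⟩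
    · choose x y h₁ h₂ using he
      exact ⟨_, _, hC.op g _ _ _ h₁, hC.op g _ _ _ h₂⟩
    · rintro _ _ ⟨x, y, h₁, h₂⟩
      exact ⟨x, y, h₂, h₁⟩
    · rintro a b c ⟨x, y, h₁, h₂⟩ ⟨x', y', h₃, h₄⟩
      refine ⟨p x x' x', p y y' y', ?_, ?_⟩
      · simpa only [hpr] using hC.pres₃ hp h₁ h₃ h₃
      · simpa only [hpl] using hC.pres₃ hp h₂ h₃ h₄
  rcases hsimp _ hc with hd | hd
  · have : (y, y') ∈ {e : Z × Z | ∃ x w, R x e.1 w ∧ R x e.2 w} := ⟨x, w, h, h'⟩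
    rw [hd] at this
    exact this
  · exfalso
    obtain ⟨z, hz⟩ := hnt
    obtain ⟨x, w, h₁, h₂⟩ : (z, o) ∈ {e : Z × Z | ∃ x w, R x e.1 w ∧ R x e.2 w} :=
      hd ▸ Set.mem_univ _
    have h₃ := hC.pres₃ hp h₁ h₂ (hC.zero_right o)
    rw [hpl, hpr, hpl] at h₃
    exact hz (hC.left _ _ h₃)

theorem abelian : Centralizes S (Set.univ : Set (Z × Z)) Set.univ (diag Z) := by
  intro n t a b c d _ _ h
  have hcons : ∀ (a : Z) (c : Fin n → Z), R (t.eval (Fin.cons a fun _ => o))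
      (t.eval (Fin.cons o c)) (t.eval (Fin.cons a c)) := fun a c => by
    refine t.eval_rel hC.op fun i => ?_
    refine Fin.cases ?_ (fun j => ?_) i
    · exact hC.zero_right a
    · exact hC.zero_left (c j)
  have hac := hcons a c
  have had := hcons a d
  rw [show t.eval (Fin.cons a c) = t.eval (Fin.cons a d) from h] at hac
  have hcd := hC.injective hp hpl hpr hnt hsimp hac had
  have hbc := hcons b c
  rw [hcd] at hbc
  exact hC.functional hp hpl hpr hnt hsimp hbc (hcons b d)

end

end PartialSum

/-- The graph `D` of a difference map from pairs of elements of `A` to `Z`, in which `o` is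
the difference of equal elements. -/
structure DifferenceMap (S : Signature) {A Z : Type} [SAlg S A] [SAlg S Z]
    (D : A → A → Z → Prop) (o : Z) : Prop where
  op : ∀ (f : S.ops) (a b : Fin (S.arity f) → A) (z : Fin (S.arity f) → Z),
    (∀ i, D (a i) (b i) (z i)) → D (SAlg.interp f a) (SAlg.interp f b) (SAlg.interp f z)
  uniq : ∀ a b z z', D a b z → D a b z' → z = z'
  surj : ∀ z, ∃ a b, D a b z
  diag : ∀ a, D a a o
  shift : ∀ a b c y w, D a b o → D b c y → D a c w → y = w
  gen : ∀ B : Set Z, IsSubuniverse S B → o ∈ B → ∀ z ∈ B, z ≠ o → B = Set.univ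

namespace DifferenceMap

variable {S : Signature} {A Z : Type} [SAlg S A] [SAlg S Z] {D : A → A → Z → Prop} {o : Z}

/-- The partial addition of differences. -/
def sum (D : A → A → Z → Prop) (x y w : Z) : Prop := ∃ a b c, D a b x ∧ D b c y ∧ D a c w

variable (hD : DifferenceMap S D o)
include hD

theorem sum_op (f : S.ops) (x y w : Fin (S.arity f) → Z) (h : ∀ i, sum D (x i) (y i) (w i)) :
    sum D (SAlg.interp f x) (SAlg.interp f y) (SAlg.interp f w) := by
  choose a b c h₁ h₂ h₃ using h
  exact ⟨_, _, _, hD.op f _ _ _ h₁, hD.op f _ _ _ h₂, hD.op f _ _ _ h₃⟩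

theorem iter_zero {N : ℕ} (hN : 0 < N)
    (hA : ∀ (f : A → A) (a : A), f^[N] (f^[N] a) = f^[N] a) {r : Z → Z → Z}
    (hr : IsTermOp₂ S r) (hi : ∀ z, r z z = z) (y : Z) :
    iter₂ r N (iter₂ r N o y) o = o := by
  obtain ⟨t, ht⟩ := hr
  obtain ⟨M, hM⟩ := Nat.exists_eq_succ_of_ne_zero hN.ne'
  have hrD : ∀ {a b z a' b' z'}, D a b z → D a' b' z' →
      D (t.eval ![a, a']) (t.eval ![b, b']) (r z z') := fun {a b z a' b' z'} h h' => by
    have h₁ := t.eval_rel₂ hD.op h h'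
    rw [ht] at h₁
    exact h₁
  set d : A → A := fun a => t.eval ![a, a] with hd
  have hdD : ∀ k {a b z}, D a b z → D (d^[k] a) (d^[k] b) z := by
    intro k
    induction k with
    | zero => exact fun h => h
    | succ k ih =>
      intro a b z h
      rw [Function.iterate_succ_apply', Function.iterate_succ_apply']
      have := hrD (ih h) (ih h)
      rwa [hi] at this
  set s : A → A → A := fun a b => d^[M] (t.eval ![a, b]) with hs
  have hsD : ∀ {a b z a' b' z'}, D a b z → D a' b' z' → D (s a a') (s b b') (r z z') :=
    fun h h' => hdD M (hrD h h')
  have hiD : ∀ k {a b z a' b' z'}, D a b z → D a' b' z' →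
      D (iter₂ s k a a') (iter₂ s k b b') (iter₂ r k z z') := by
    intro k
    induction k with
    | zero => exact fun h _ => h
    | succ k ih =>
      intro a b z a' b' z' h h'
      rw [iter₂_succ, iter₂_succ, iter₂_succ]
      exact hsD (ih h h') h'
  obtain ⟨a₀, b₀, h₀⟩ := hD.surj y
  set a := d^[N] a₀ with ha
  set b := d^[N] b₀
  have h : D a b y := hdD N h₀
  have hsa : s a a = a := by
    change d^[M] (d a) = a
    rw [← Function.iterate_succ_apply, ← hM, ha, hA]
  have h₁ := hiD N (hD.diag a) h
  rw [show iter₂ s N a a = a from Function.iterate_fixed (f := fun u => s u a) hsa N] at h₁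
  have h₂ := hiD N h₁ (hD.diag b)
  rw [show iter₂ s N (iter₂ s N a b) b = iter₂ s N a b from hA _ _] at h₂
  exact hD.uniq _ _ _ _ h₂ (hD.diag _)

theorem exists_partialSum [Finite A] [Finite Z] : ∃ N, PartialSum S (sum D) o N := by
  obtain ⟨N₁, hN₁, hA⟩ := exists_iterate_idempotent A
  obtain ⟨N₂, hN₂, hZ⟩ := exists_iterate_idempotent Z
  have left : ∀ y w, sum D o y w → y = w := by
    rintro y w ⟨a, b, c, h₁, h₂, h₃⟩
    exact hD.shift a b c y w h₁ h₂ h₃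
  have zero_left : ∀ x, sum D o x x := fun x => by
    obtain ⟨a, b, h⟩ := hD.surj x
    exact ⟨a, a, b, hD.diag a, h, h⟩
  have zero_right : ∀ x, sum D x o x := fun x => by
    obtain ⟨a, b, h⟩ := hD.surj x
    exact ⟨a, b, b, h, hD.diag b, h⟩
  have hpos : 0 < N₁ * N₂ := Nat.mul_pos hN₁ hN₂
  have hZ' : ∀ (f : Z → Z) (z : Z), f^[N₁ * N₂] (f^[N₁ * N₂] z) = f^[N₁ * N₂] z := by
    rw [mul_comm]
    exact hZ N₁ hN₁
  refine ⟨N₁ * N₂, hD.sum_op, left, zero_right, zero_left, fun f => ?_, hD.gen, hpos, hZ', ?_⟩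
  · obtain ⟨a, b, -⟩ := hD.surj o
    exact hD.uniq _ _ _ _ (hD.op f (fun _ => a) (fun _ => a) _ fun _ => hD.diag a) (hD.diag _)
  · intro r hr hi
    have key : ∀ x y z, iter₂ r (N₁ * N₂) (iter₂ r (N₁ * N₂) x o) z =
        iter₂ r (N₁ * N₂) (iter₂ r (N₁ * N₂) x y) z := by
      intro x y z
      obtain ⟨t, ht⟩ := hr.iter (N₁ * N₂)
      have hF : ∀ {x y w x' y' w'}, sum D x y w → sum D x' y' w' →
          sum D (iter₂ r (N₁ * N₂) x x') (iter₂ r (N₁ * N₂) y y') (iter₂ r (N₁ * N₂) w w') :=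
        fun h h' => by
          have h₁ := t.eval_rel₂ hD.sum_op h h'
          rw [ht, ht, ht] at h₁
          exact h₁
      have h := hF (hF (zero_left x) (zero_right y)) (zero_left z)
      rw [hD.iter_zero hpos (hA N₂ hN₂) hr hi] at h
      exact left _ _ h
    intro x y z
    rw [← key x y z, key x z z]
    exact hZ' _ _

theorem isTaylorOp {n : ℕ} {t : STerm S n} {u v : Fin n → Fin n → Fin 2}
    (hne : ∀ i, u i i ≠ v i i) (ht : TaylorOn S A t u v) :
    IsTaylorOp (fun w : Fin n → Z => t.eval w) u v where
  self z := by
    obtain ⟨a, b, h⟩ := hD.surj z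
    have h' := t.eval_rel hD.op (a := fun _ => a) (b := fun _ => b) (c := fun _ => z) fun _ => h
    rw [ht.1, ht.1] at h'
    exact hD.uniq _ _ _ _ h' h
  ne := hne
  eq i x y := by
    obtain ⟨a, b, h⟩ := hD.surj x
    obtain ⟨a', b', h'⟩ := hD.surj y
    have key : ∀ s : Fin n → Fin 2, D (t.eval fun j => if s j = 0 then a else a')
        (t.eval fun j => if s j = 0 then b else b') (t.eval fun j => if s j = 0 then x else y) := by
      refine fun s => t.eval_rel hD.op fun j => ?_
      split_ifs
      exacts [h, h']
    have h₁ := key (u i)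
    rw [ht.2, ht.2] at h₁
    exact hD.uniq _ _ _ _ h₁ (key (v i))

end DifferenceMap

section SyntacticCongruence

variable (S : Signature) {X : Type} [SAlg S X]

/-- Compositions of basic unary translations of an algebra. -/
inductive Translation : (X → X) → Prop
  | id : Translation fun p => p
  | step (f : S.ops) (j : Fin (S.arity f)) (c : Fin (S.arity f) → X) {g : X → X} :
      Translation g → Translation fun p => SAlg.interp f (Function.update c j (g p))

/-- The largest congruence for which `K` is a union of classes. -/
def syntacticSetoid (K : Set X) : Setoid X where
  r p q := ∀ g, Translation S g → (g p ∈ K ↔ g q ∈ K)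
  iseqv := ⟨fun _ _ _ => Iff.rfl, fun h g hg => (h g hg).symm,
    fun h h' g hg => (h g hg).trans (h' g hg)⟩

variable {S}

theorem Translation.comp_basic {g : X → X} (hg : Translation S g) (f : S.ops)
    (j : Fin (S.arity f)) (c : Fin (S.arity f) → X) :
    Translation S fun p => g (SAlg.interp f (Function.update c j p)) := by
  induction hg with
  | id => exact .step f j c .id
  | step f' j' c' _ ih => exact .step f' j' c' ih

theorem syntacticSetoid_interp {K : Set X} (f : S.ops) {x y : Fin (S.arity f) → X}
    (h : ∀ i, (syntacticSetoid S K).r (x i) (y i)) :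
    (syntacticSetoid S K).r (SAlg.interp f x) (SAlg.interp f y) := by
  have key : ∀ J : Finset (Fin (S.arity f)), (syntacticSetoid S K).r (SAlg.interp f x)
      (SAlg.interp f fun i => if i ∈ J then y i else x i) := by
    intro J
    induction J using Finset.induction_on with
    | empty => simpa only [Finset.notMem_empty, if_false] using (syntacticSetoid S K).iseqv.refl _
    | insert j J hj ih =>
      refine (syntacticSetoid S K).iseqv.trans ih fun g hg => ?_
      have := h j _ (hg.comp_basic f j fun i => if i ∈ J then y i else x i)
      convert this using 4
      · funext i
        by_cases hi : i = j
        · subst hi; simp [hj]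
        · simp [hi]
      · funext i
        by_cases hi : i = j
        · subst hi; simp
        · simp [hi]
  simpa using key Finset.univ

variable (S) in
/-- The quotient by the syntactic congruence. -/
def SyntacticQuotient (K : Set X) : Type := Quotient (syntacticSetoid S K)

variable (S) in
/-- The quotient map. -/
def SyntacticQuotient.mk (K : Set X) (p : X) : SyntacticQuotient S K :=
  Quotient.mk (syntacticSetoid S K) p

noncomputable instance (K : Set X) : SAlg S (SyntacticQuotient S K) :=
  ⟨fun f x => .mk S K (SAlg.interp f fun i => Quotient.out (x i))⟩

namespace SyntacticQuotient

variable {K : Set X}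

theorem mk_surjective : Function.Surjective (mk S K) := Quotient.exists_rep

theorem mk_eq {p q : X} : mk S K p = mk S K q ↔ ∀ g, Translation S g → (g p ∈ K ↔ g q ∈ K) :=
  Quotient.eq (r := syntacticSetoid S K)

theorem mk_interp (f : S.ops) (x : Fin (S.arity f) → X) :
    mk S K (SAlg.interp f x) = SAlg.interp f fun i => mk S K (x i) := by
  refine Quotient.sound (s := syntacticSetoid S K) (syntacticSetoid_interp f fun i => ?_)
  exact (syntacticSetoid S K).iseqv.symm
    (Quotient.mk_out (s := syntacticSetoid S K) (x i))

instance [Finite X] : Finite (SyntacticQuotient S K) := Finite.of_surjective _ mk_surjective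

end SyntacticQuotient

end SyntacticCongruence

/-- The setting in which the syntactic quotient is a difference map: `π` identifies `X` with the
subalgebra `L` of `A²`, where `L` is a minimal `ρ`-saturated subuniverse above `ρ`, and `T` is a
bridge from `(A, ρ, L)` to itself with full trace. -/
structure FullBridge (S : Signature) {A X : Type} [SAlg S A] [SAlg S X] (ρ L : Set (A × A))
    (T : Set (A × A × A × A)) (π : X → A × A) : Prop where
  hom : ∀ (f : S.ops) (x : Fin (S.arity f) → X),
    π (SAlg.interp f x) = SAlg.interp f fun i => π (x i)
  inj : Function.Injective π
  range : Set.range π = L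
  con : IsCongruence S ρ
  cov : L ∈ Cov S ρ
  bridge : IsBridgeLR S ρ ρ L L T
  full : ∀ a b, (a, a, b, b) ∈ T

namespace FullBridge

variable {S : Signature} {A X : Type} [SAlg S A] [SAlg S X] {ρ L : Set (A × A)}
  {T : Set (A × A × A × A)} {π : X → A × A}

/-- The graph of the quotient map, as a relation on `A × A`. -/
def diff (S : Signature) [SAlg S X] (ρ : Set (A × A)) (π : X → A × A) (a b : A)
    (z : SyntacticQuotient S (π ⁻¹' ρ)) : Prop :=
  ∃ p, π p = (a, b) ∧ SyntacticQuotient.mk S (π ⁻¹' ρ) p = z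

variable (h : FullBridge S ρ L T π)
include h

theorem mem_L (p : X) : π p ∈ L := h.range ▸ ⟨p, rfl⟩

theorem exists_of_mem {a b : A} (hab : (a, b) ∈ L) : ∃ p, π p = (a, b) := by
  rw [← h.range] at hab
  exact hab

theorem exists_related (p : X) : ∃ s, ((π p).1, (π p).2, (π s).1, (π s).2) ∈ T := by
  have hp := h.mem_L p
  rw [← h.bridge.2.1] at hp
  obtain ⟨b₁, b₂, hb⟩ := hp
  have hs : (b₁, b₂) ∈ L := by
    rw [← h.bridge.2.2]
    exact ⟨_, _, hb⟩
  obtain ⟨s, hs⟩ := h.exists_of_mem hs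
  exact ⟨s, by rw [hs]; exact hb⟩

theorem exists_translation {g : X → X} (hg : Translation S g) :
    ∃ g' : X → X, ∀ p s, ((π p).1, (π p).2, (π s).1, (π s).2) ∈ T →
      ((π (g p)).1, (π (g p)).2, (π (g' s)).1, (π (g' s)).2) ∈ T := by
  induction hg with
  | id => exact ⟨fun s => s, fun _ _ h => h⟩
  | step f j c _ ih =>
    obtain ⟨g', hg'⟩ := ih
    choose c' hc' using fun i => h.exists_related (c i)
    refine ⟨fun s => SAlg.interp f (Function.update c' j (g' s)), fun p s hps => ?_⟩
    rw [h.hom, h.hom]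
    refine h.bridge.1.1 f (fun i => ((π (Function.update c j _ i)).1,
      (π (Function.update c j _ i)).2, (π (Function.update c' j (g' s) i)).1,
      (π (Function.update c' j (g' s) i)).2)) fun i => ?_
    by_cases hi : i = j
    · subst hi; simpa using hg' p s hps
    · simpa [hi] using hc' i

theorem mk_eq_of_related {p q s : X} (hp : ((π p).1, (π p).2, (π s).1, (π s).2) ∈ T)
    (hq : ((π q).1, (π q).2, (π s).1, (π s).2) ∈ T) :
    SyntacticQuotient.mk S (π ⁻¹' ρ) p = SyntacticQuotient.mk S (π ⁻¹' ρ) q := by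
  rw [SyntacticQuotient.mk_eq]
  intro g hg
  obtain ⟨g', hg'⟩ := h.exists_translation hg
  have hB := h.bridge.1.2.2.2.2.2
  exact (hB _ _ _ _ (hg' p s hp)).trans (hB _ _ _ _ (hg' q s hq)).symm

theorem mk_eq_of_congr {p q : X} (h₁ : ((π p).1, (π q).1) ∈ ρ) (h₂ : ((π p).2, (π q).2) ∈ ρ) :
    SyntacticQuotient.mk S (π ⁻¹' ρ) p = SyntacticQuotient.mk S (π ⁻¹' ρ) q := by
  obtain ⟨s, hs⟩ := h.exists_related p
  exact h.mk_eq_of_related hs (h.bridge.1.2.1 _ _ _ _ _ _ hs h₁ h₂)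

theorem mk_eq_mk_diag {p p₀ : X} {a₀ : A} (hp₀ : π p₀ = (a₀, a₀)) :
    SyntacticQuotient.mk S (π ⁻¹' ρ) p = SyntacticQuotient.mk S (π ⁻¹' ρ) p₀ ↔ π p ∈ ρ := by
  constructor
  · intro hp
    have := (SyntacticQuotient.mk_eq.1 hp _ .id).2
    refine this ?_
    rw [Set.mem_preimage, hp₀]
    exact h.con.2.refl a₀
  · intro hp
    obtain ⟨q, hq⟩ := h.exists_of_mem (h.cov.2.2.1.1 (h.con.2.refl (π p).1))
    refine (h.mk_eq_of_congr (q := q) ?_ ?_).trans (h.mk_eq_of_related (s := p₀) ?_ ?_)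
    · rw [hq]; exact h.con.2.refl _
    · rw [hq]; exact h.con.2.symm hp
    · rw [hq, hp₀]; exact h.full _ _
    · rw [hp₀]; exact h.full _ _

theorem differenceMap {p₀ : X} {a₀ : A} (hp₀ : π p₀ = (a₀, a₀)) :
    DifferenceMap S (diff S ρ π) (SyntacticQuotient.mk S (π ⁻¹' ρ) p₀) where
  op f a b z hz := by
    choose p hp hpz using hz
    refine ⟨SAlg.interp f p, ?_, ?_⟩
    · rw [h.hom]
      simp only [hp]
      rfl
    · rw [SyntacticQuotient.mk_interp]
      simp only [hpz]
  uniq := by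
    rintro a b z z' ⟨p, hp, rfl⟩ ⟨q, hq, rfl⟩
    rw [h.inj (hp.trans hq.symm)]
  surj z := by
    obtain ⟨p, rfl⟩ := SyntacticQuotient.mk_surjective z
    exact ⟨_, _, p, rfl, rfl⟩
  diag a := by
    obtain ⟨q, hq⟩ := h.exists_of_mem (h.cov.2.2.1.1 (h.con.2.refl a))
    refine ⟨q, hq, (h.mk_eq_mk_diag hp₀).2 ?_⟩
    rw [hq]
    exact h.con.2.refl a
  shift := by
    rintro a b c y w ⟨p, hp, hpo⟩ ⟨q, hq, rfl⟩ ⟨r, hr, rfl⟩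
    rw [h.mk_eq_mk_diag hp₀, hp] at hpo
    apply h.mk_eq_of_congr
    · rw [hq, hr]; exact h.con.2.symm hpo
    · rw [hq, hr]; exact h.con.2.refl c
  gen B hB ho z hz hzo := by
    obtain ⟨p, rfl⟩ := SyntacticQuotient.mk_surjective z
    have hL := h.cov.2.2.2 {e | ∃ p, π p = e ∧ SyntacticQuotient.mk S (π ⁻¹' ρ) p ∈ B}
      (by
        intro f x hx
        choose q hq hqB using hx
        refine ⟨SAlg.interp f q, by rw [h.hom]; simp only [hq], ?_⟩
        rw [SyntacticQuotient.mk_interp]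
        exact hB f _ hqB)
      (by
        apply Set.Subset.antisymm
        · rintro ⟨a, b⟩ ⟨a', haa', b', ⟨q, hq, hqB⟩, hbb'⟩
          have hab : (a, b) ∈ L := by
            rw [← h.cov.2.1]
            exact ⟨a', haa', b', hq ▸ h.mem_L q, hbb'⟩
          obtain ⟨q', hq'⟩ := h.exists_of_mem hab
          refine ⟨q', hq', ?_⟩
          rwa [h.mk_eq_of_congr (p := q') (q := q)]
          · rw [hq, hq']; exact haa'
          · rw [hq, hq']; exact h.con.2.symm hbb'
        · rintro ⟨a, b⟩ hab
          exact ⟨a, h.con.2.refl a, b, hab, h.con.2.refl b⟩)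
      (by
        refine ⟨?_, fun hsub => hzo ((h.mk_eq_mk_diag hp₀).2 (hsub ⟨p, rfl, hz⟩))⟩
        rintro ⟨a, b⟩ hab
        obtain ⟨q, hq⟩ := h.exists_of_mem (h.cov.2.2.1.1 hab)
        refine ⟨q, hq, ?_⟩
        rwa [(h.mk_eq_mk_diag hp₀).2 (hq ▸ hab)])
      (by
        rintro _ ⟨q, rfl, -⟩
        exact h.mem_L q)
    refine Set.eq_univ_of_forall fun z' => ?_
    obtain ⟨q, rfl⟩ := SyntacticQuotient.mk_surjective z'
    have hq := h.mem_L q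
    rw [← hL] at hq
    obtain ⟨q', hq', hB'⟩ := hq
    rwa [h.inj hq'] at hB'

theorem simple {p₀ : X} {a₀ : A} (hp₀ : π p₀ = (a₀, a₀))
    (hzero : IsSubuniverse S {SyntacticQuotient.mk S (π ⁻¹' ρ) p₀})
    (θ : Set (SyntacticQuotient S (π ⁻¹' ρ) × SyntacticQuotient S (π ⁻¹' ρ)))
    (hθ : IsCongruence S θ) : θ = diag _ ∨ θ = Set.univ := by
  set o := SyntacticQuotient.mk S (π ⁻¹' ρ) p₀ with ho
  by_cases hz : ∃ z, (o, z) ∈ θ ∧ z ≠ o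
  · right
    obtain ⟨z, hz, hzo⟩ := hz
    have huniv := (h.differenceMap hp₀).gen {z | (o, z) ∈ θ} (by
      intro f x hx
      have hf : SAlg.interp f (fun _ => o) = o := hzero f _ fun _ => rfl
      have := hθ.1 f (fun i => (o, x i)) hx
      change (SAlg.interp f (fun _ => o), SAlg.interp f x) ∈ θ at this
      rwa [hf] at this) (hθ.2.refl o) z hz hzo
    have hall : ∀ z, (o, z) ∈ θ := fun z => by
      have : z ∈ {z | (o, z) ∈ θ} := huniv ▸ Set.mem_univ z
      exact this
    exact Set.eq_univ_of_forall fun e => hθ.2.trans (hθ.2.symm (hall e.1)) (hall e.2)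
  · left
    push Not at hz
    have htrans : ∀ {g : X → X}, Translation S g → ∀ p q,
        (SyntacticQuotient.mk S (π ⁻¹' ρ) p, SyntacticQuotient.mk S (π ⁻¹' ρ) q) ∈ θ →
        (SyntacticQuotient.mk S (π ⁻¹' ρ) (g p), SyntacticQuotient.mk S (π ⁻¹' ρ) (g q)) ∈ θ := by
      intro g hg p q hpq
      induction hg with
      | id => exact hpq
      | step f j c _ ih =>
        rw [SyntacticQuotient.mk_interp, SyntacticQuotient.mk_interp]
        refine hθ.1 f (fun i => (SyntacticQuotient.mk S (π ⁻¹' ρ) (Function.update c j _ i),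
          SyntacticQuotient.mk S (π ⁻¹' ρ) (Function.update c j _ i))) fun i => ?_
        by_cases hi : i = j
        · subst hi; simpa using ih
        · simpa [hi] using hθ.2.refl _
    have hmem : ∀ p q,
        (SyntacticQuotient.mk S (π ⁻¹' ρ) p, SyntacticQuotient.mk S (π ⁻¹' ρ) q) ∈ θ → π p ∈ ρ → π q ∈ ρ := by
      intro p q hpq hp
      rw [← h.mk_eq_mk_diag hp₀] at hp ⊢
      rw [hp] at hpq
      exact hz _ hpq
    apply Set.Subset.antisymm
    · rintro ⟨z, z'⟩ hzz'
      obtain ⟨p, rfl⟩ := SyntacticQuotient.mk_surjective z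
      obtain ⟨q, rfl⟩ := SyntacticQuotient.mk_surjective z'
      refine SyntacticQuotient.mk_eq.2 fun g hg => ⟨hmem _ _ (htrans hg p q hzz'),
        hmem _ _ (htrans hg q p (hθ.2.symm hzz'))⟩
    · rintro ⟨z, z'⟩ hzz'
      obtain rfl : z = z' := hzz'
      exact hθ.2.refl z

end FullBridge

end Zhuk

/-- if `ρ` is irreducible with `Opt(ρ) = 1_A`, there is a simple affine
algebra `Z ∈ HS(A²)` with a one-element subuniverse `{0}` and a subdirect
`ζ ≤ A×A×Z` with `pr₁₂(ζ) = ρ*` such that `(a,a') ∈ ρ ↔ b = 0` for `(a,a',b) ∈ ζ`. -/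
theorem stmt_11 {S : Zhuk.Signature} {A : Type} [iA : Zhuk.SAlg S A] [Finite A]
    (hTay : Zhuk.IsTaylorAlg S A)
    (ρ ρstar : Set (A × A)) (hρ : Zhuk.ConStar S ρ)
    (hirr : Zhuk.Cov S ρ = {ρstar})
    (hopt : Zhuk.IsOptOf S ρ ρstar Set.univ) :
    ∃ (Z : Type) (iZ : Zhuk.SAlg S Z),
      letI := iZ
      -- `Z ∈ HS(A²)`
      (∃ (R : Set (A × A)) (hR : Zhuk.IsSubuniverse S R) (g : ↥R → Z),
        Function.Surjective g ∧ Zhuk.IsHomI (Zhuk.subAlg R hR) iZ g) ∧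
      -- `Z` is simple
      (∀ θ : Set (Z × Z), Zhuk.IsCongruence S θ → θ = Zhuk.diag Z ∨ θ = Set.univ) ∧
      -- `Z` is abelian
      Zhuk.Centralizes S (Set.univ : Set (Z × Z)) Set.univ (Zhuk.diag Z) ∧
      -- `Z` has a Maltsev term
      (∃ p : Zhuk.STerm S 3, ∀ x y : Z,
        p.eval ![x, x, y] = y ∧ p.eval ![y, x, x] = y) ∧
      -- one-element subuniverse `{0}` and the relation `ζ`
      ∃ z0 : Z, Zhuk.IsSubuniverse S ({z0} : Set Z) ∧
        ∃ ζ : Set (A × A × Z),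
          Zhuk.IsSubuniverse S ζ ∧
          (∀ a : A, ∃ p ∈ ζ, p.1 = a) ∧
          (∀ a : A, ∃ p ∈ ζ, p.2.1 = a) ∧
          (∀ z : Z, ∃ p ∈ ζ, p.2.2 = z) ∧
          {q : A × A | ∃ z : Z, (q.1, q.2, z) ∈ ζ} = ρstar ∧
          (∀ (a a' : A) (z : Z), (a, a', z) ∈ ζ → ((a, a') ∈ ρ ↔ z = z0)) := by
  obtain ⟨n, t, u, v, -, hne, ht⟩ := hTay
  obtain ⟨⟨T, hT, -, htr⟩, -⟩ := hopt
  have hcov : ρstar ∈ Zhuk.Cov S ρ := hirr ▸ rfl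
  let _ : Zhuk.SAlg S ↥ρstar := Zhuk.subAlg ρstar hcov.1
  have hB : Zhuk.FullBridge S ρ ρstar T (Subtype.val : ↥ρstar → A × A) :=
    { hom := fun _ _ => rfl
      inj := Subtype.val_injective
      range := Subtype.range_val
      con := hρ.1
      cov := hcov
      bridge := hT
      full := fun a b => by
        have : (a, b) ∈ Zhuk.btr T := htr ▸ Set.mem_univ _
        exact this }
  obtain ⟨q, hq, hqρ⟩ := Set.exists_of_ssubset hcov.2.2.1
  obtain ⟨p₀, hp₀⟩ := hB.exists_of_mem (hcov.2.2.1.1 (hρ.1.2.refl q.1))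
  have hD := hB.differenceMap hp₀
  obtain ⟨N, hC⟩ := hD.exists_partialSum
  set o := Zhuk.SyntacticQuotient.mk S (Subtype.val ⁻¹' ρ) p₀ with ho
  have hzero : Zhuk.IsSubuniverse S {o} := fun f x hx => by
    rw [show x = fun _ => o from funext hx]
    exact hC.zero f
  have hsimp := hB.simple hp₀ hzero
  have hnt : ∃ z, z ≠ o := ⟨_, fun h => hqρ ((hB.mk_eq_mk_diag (p := ⟨q, hq⟩) hp₀).1 h)⟩
  obtain ⟨m, hm, hml, hmr⟩ := hC.exists_maltsev ⟨t, fun _ => rfl⟩ (hD.isTaylorOp hne ht)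
  refine ⟨Zhuk.SyntacticQuotient S (Subtype.val ⁻¹' ρ : Set ↥ρstar), inferInstance,
    ⟨ρstar, hcov.1, Zhuk.SyntacticQuotient.mk S _, Zhuk.SyntacticQuotient.mk_surjective,
      Zhuk.SyntacticQuotient.mk_interp⟩, hsimp, hC.abelian hm hml hmr hnt hsimp, ?_, o, hzero,
    {e | Zhuk.FullBridge.diff S ρ (Subtype.val : ↥ρstar → A × A) e.1 e.2.1 e.2.2},
    fun f x hx => hD.op f _ _ _ hx, fun a => ⟨(a, a, o), hD.diag a, rfl⟩,
    fun a => ⟨(a, a, o), hD.diag a, rfl⟩, fun z => ?_, ?_, ?_⟩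
  · obtain ⟨s, hs⟩ := hm
    refine ⟨s, fun x y => ⟨?_, ?_⟩⟩
    · rw [hs]
      exact hml x y
    · rw [hs]
      exact hmr y x
  · obtain ⟨a, b, h⟩ := hD.surj z
    exact ⟨(a, b, z), h, rfl⟩
  · ext ⟨a, b⟩
    constructor
    · rintro ⟨_, ⟨p, hp, -⟩⟩
      have hp : p.1 = (a, b) := hp
      exact hp ▸ p.2
    · exact fun hab => ⟨_, ⟨(a, b), hab⟩, rfl, rfl⟩
  · rintro a b z ⟨p, hp, rfl⟩
    have hp : p.1 = (a, b) := hp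
    rw [← hp]
    exact (hB.mk_eq_mk_diag hp₀).symm
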